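/- (Discussion estimate) Let A be a finite family of n rectangles with widths wᵢ and heights lᵢ, let M₀ be a positioning of A with T(M₀) = T₀(A), let Δx > 0, and let A′ be the family obtained from A by replacing w₁ with w₁ + Δx. If η₀(A′) < η₀(A), then η₀(A) − η₀(A′) ≤ η₀(A) − l₁/q(M₀); consequently η₀(A′) ≥ l₁/q(M₀) and also η₀(A) ≥ l₁/q(M₀). -/

import Mathlib

open Set Finset Function

/-- A positioning of a family of rectangles (widths `w`, heights `l`) assigns
lower-left corners `(a i, b i)` so that the open interiors are pairwise disjoint. -/
def IsPositioning {ι : Type*} (w l a b : ι → ℝ) : Prop :=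
  ∀ i j, i ≠ j →
    Disjoint (Set.Ioo (a i) (a i + w i) ×ˢ Set.Ioo (b i) (b i + l i))
             (Set.Ioo (a j) (a j + w j) ×ˢ Set.Ioo (b j) (b j + l j))

/-- Horizontal extent `p(M) = max_{i,j} ((a i + w i) - a j)`. -/
noncomputable def pval {n : ℕ} (w a : Fin n → ℝ) : ℝ :=
  ⨆ i, ⨆ j, (a i + w i - a j)

/-- Vertical extent `q(M) = max_{i,j} ((b i + l i) - b j)`. -/
noncomputable def qval {n : ℕ} (l b : Fin n → ℝ) : ℝ :=
  ⨆ i, ⨆ j, (b i + l i - b j)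

/-- Bounding area `T(M) = p(M) * q(M)`. -/
noncomputable def Tval {n : ℕ} (w l a b : Fin n → ℝ) : ℝ :=
  pval w a * qval l b

/-- Total area `S(A) = ∑ i, w i * l i`. -/
noncomputable def Sval {n : ℕ} (w l : Fin n → ℝ) : ℝ :=
  ∑ i, w i * l i

/-- Packing efficiency `η(M) = S(A) / T(M)`. -/
noncomputable def eta {n : ℕ} (w l a b : Fin n → ℝ) : ℝ :=
  Sval w l / Tval w l a b

/-- Best packing efficiency `η₀(A) = sup over positionings M of η(M)`. -/
noncomputable def eta0 {n : ℕ} (w l : Fin n → ℝ) : ℝ :=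
  sSup {e | ∃ a b : Fin n → ℝ, IsPositioning w l a b ∧ e = eta w l a b}

/-- Minimal bounding area `T₀(A) = inf over positionings M of T(M)`. -/
noncomputable def T0 {n : ℕ} (w l : Fin n → ℝ) : ℝ :=
  sInf {t | ∃ a b : Fin n → ℝ, IsPositioning w l a b ∧ t = Tval w l a b}

theorem disjoint_Ioo_add_iff {x y u v : ℝ} (hu : 0 < u) (hv : 0 < v) :
    Disjoint (Set.Ioo x (x + u)) (Set.Ioo y (y + v)) ↔ x + u ≤ y ∨ y + v ≤ x := by
  rw [Set.Ioo_disjoint_Ioo, min_le_iff, le_max_iff, le_max_iff]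
  grind

theorem isPositioning_iff {ι : Type*} {w l a b : ι → ℝ} (hw : ∀ i, 0 < w i)
    (hl : ∀ i, 0 < l i) :
    IsPositioning w l a b ↔ ∀ i j, i ≠ j →
      (a i + w i ≤ a j ∨ a j + w j ≤ a i) ∨ (b i + l i ≤ b j ∨ b j + l j ≤ b i) := by
  simp only [IsPositioning, Set.disjoint_prod, disjoint_Ioo_add_iff (hw _) (hw _),
    disjoint_Ioo_add_iff (hl _) (hl _)]

/-- Translate by `d` every rectangle lying to the right of rectangle `k`. -/
noncomputable def shiftRight {ι : Type*} (w a : ι → ℝ) (k : ι) (d : ℝ) (i : ι) : ℝ :=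
  if a k + w k ≤ a i then a i + d else a i

theorem IsPositioning.shiftRight {ι : Type*} [DecidableEq ι] {w l a b : ι → ℝ}
    (hw : ∀ i, 0 < w i) (hl : ∀ i, 0 < l i) (h : IsPositioning w l a b) (k : ι) {d : ℝ}
    (hd : 0 < d) :
    IsPositioning (Function.update w k (w k + d)) l (shiftRight w a k d) b := by
  have hw' : ∀ i, 0 < Function.update w k (w k + d) i := by
    intro i
    rcases eq_or_ne i k with rfl | hi
    · simpa using add_pos (hw i) hd
    · simpa [hi] using hw i
  rw [isPositioning_iff hw hl] at h
  rw [isPositioning_iff hw' hl]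
  intro i j hij
  have hk := hw k
  have hi := hw i
  have hj := hw j
  have hijd := h i j hij
  simp only [_root_.shiftRight, Function.update_apply]
  grind

theorem sub_le_pval {n : ℕ} (w a : Fin n → ℝ) (i j : Fin n) : a i + w i - a j ≤ pval w a :=
  (le_ciSup (f := fun j => a i + w i - a j) (Set.finite_range _).bddAbove j).trans
    (le_ciSup (f := fun i => ⨆ j, (a i + w i - a j)) (Set.finite_range _).bddAbove i)

theorem le_pval {n : ℕ} (w a : Fin n → ℝ) (i : Fin n) : w i ≤ pval w a := by
  simpa using sub_le_pval w a i i

theorem le_qval {n : ℕ} (l b : Fin n → ℝ) (i : Fin n) : l i ≤ qval l b :=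
  le_pval l b i

theorem pval_shiftRight_le {n : ℕ} {w : Fin n → ℝ} (hw : ∀ i, 0 < w i) (a : Fin n → ℝ)
    (k : Fin n) {d : ℝ} (hd : 0 < d) :
    pval (Function.update w k (w k + d)) (shiftRight w a k d) ≤ pval w a + d := by
  have : Nonempty (Fin n) := ⟨k⟩
  refine ciSup_le fun i => ciSup_le fun j => ?_
  have hij := sub_le_pval w a i j
  have hk := hw k
  simp only [shiftRight, Function.update_apply]
  grind

theorem mul_le_Tval {n : ℕ} {w l : Fin n → ℝ} (hw : ∀ i, 0 < w i) (hl : ∀ i, 0 < l i)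
    (a b : Fin n → ℝ) (i : Fin n) : w i * l i ≤ Tval w l a b :=
  mul_le_mul (le_pval w a i) (le_qval l b i) (hl i).le ((hw i).le.trans (le_pval w a i))

theorem Sval_nonneg {n : ℕ} {w l : Fin n → ℝ} (hw : ∀ i, 0 < w i) (hl : ∀ i, 0 < l i) :
    0 ≤ Sval w l :=
  Finset.sum_nonneg fun i _ => (mul_pos (hw i) (hl i)).le

theorem Sval_update {n : ℕ} (w l : Fin n → ℝ) (k : Fin n) (d : ℝ) :
    Sval (Function.update w k (w k + d)) l = Sval w l + d * l k := by
  have h : ∀ i, Function.update w k (w k + d) i * l i =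
      w i * l i + if i = k then d * l k else 0 := by
    intro i
    rcases eq_or_ne i k with rfl | hi
    · simp [add_mul]
    · simp [hi]
  simp [Sval, h, Finset.sum_add_distrib]

theorem eta_le_eta0 {n : ℕ} {w l a b : Fin (n + 1) → ℝ} (hw : ∀ i, 0 < w i)
    (hl : ∀ i, 0 < l i) (h : IsPositioning w l a b) : eta w l a b ≤ eta0 w l := by
  refine le_csSup ⟨Sval w l / (w 0 * l 0), ?_⟩ ⟨a, b, h, rfl⟩
  rintro e ⟨a', b', -, rfl⟩
  exact div_le_div_of_nonneg_left (Sval_nonneg hw hl) (mul_pos (hw 0) (hl 0))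
    (mul_le_Tval hw hl a' b' 0)

theorem eta0_eq_eta {n : ℕ} {w l a b : Fin (n + 1) → ℝ} (hw : ∀ i, 0 < w i)
    (hl : ∀ i, 0 < l i) (h : IsPositioning w l a b) (hopt : Tval w l a b = T0 w l) :
    eta0 w l = eta w l a b := by
  refine le_antisymm (csSup_le ⟨_, a, b, h, rfl⟩ ?_) (eta_le_eta0 hw hl h)
  rintro e ⟨a', b', h', rfl⟩
  refine div_le_div_of_nonneg_left (Sval_nonneg hw hl)
    ((mul_pos (hw 0) (hl 0)).trans_le (mul_le_Tval hw hl a b 0)) ?_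
  rw [hopt]
  refine csInf_le ⟨0, ?_⟩ ⟨a', b', h', rfl⟩
  rintro t ⟨a'', b'', -, rfl⟩
  exact (mul_pos (hw 0) (hl 0)).le.trans (mul_le_Tval hw hl a'' b'' 0)

/-- Discussion estimate: if extending the first width by `Δx > 0` decreases
the best packing efficiency, then the decrease is at most `η₀(A) − l₁/q(M₀)` for an
optimal positioning `M₀` of `A`; consequently both `η₀(A')` and `η₀(A)` are at least
`l₁/q(M₀)`. -/
theorem eta0_decrease_estimate {n : ℕ} (w l : Fin (n + 1) → ℝ)
    (hw : ∀ i, 0 < w i) (hl : ∀ i, 0 < l i)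
    (a₀ b₀ : Fin (n + 1) → ℝ) (hM₀ : IsPositioning w l a₀ b₀)
    (hopt : Tval w l a₀ b₀ = T0 w l)
    (Δx : ℝ) (hΔx : 0 < Δx)
    (hlt : eta0 (Function.update w 0 (w 0 + Δx)) l < eta0 w l) :
    eta0 w l - eta0 (Function.update w 0 (w 0 + Δx)) l
      ≤ eta0 w l - l 0 / qval l b₀ ∧
    l 0 / qval l b₀ ≤ eta0 (Function.update w 0 (w 0 + Δx)) l ∧
    l 0 / qval l b₀ ≤ eta0 w l := by
  have hw' : ∀ i, 0 < Function.update w 0 (w 0 + Δx) i := by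
    intro i
    rcases eq_or_ne i 0 with rfl | hi
    · simpa using add_pos (hw 0) hΔx
    · simpa [hi] using hw i
  have hp : 0 < pval w a₀ := (hw 0).trans_le (le_pval w a₀ 0)
  have hq : 0 < qval l b₀ := (hl 0).trans_le (le_qval l b₀ 0)
  have hη : eta0 w l = Sval w l / (pval w a₀ * qval l b₀) := eta0_eq_eta hw hl hM₀ hopt
  have hη' : (Sval w l + Δx * l 0) / ((pval w a₀ + Δx) * qval l b₀) ≤
      eta0 (Function.update w 0 (w 0 + Δx)) l := by
    refine le_trans ?_ (eta_le_eta0 hw' hl (hM₀.shiftRight hw hl 0 hΔx))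
    rw [eta, Sval_update]
    refine div_le_div_of_nonneg_left ?_
      ((mul_pos (hw' 0) (hl 0)).trans_le (mul_le_Tval hw' hl _ _ 0))
      (mul_le_mul_of_nonneg_right (pval_shiftRight_le hw a₀ 0 hΔx) hq.le)
    exact add_nonneg (Sval_nonneg hw hl) (mul_pos hΔx (hl 0)).le
  have hS : pval w a₀ * l 0 < Sval w l := by
    have h := hη'.trans_lt (hlt.trans_eq hη)
    rw [← div_div, ← div_div, div_lt_div_iff_of_pos_right hq,
      div_lt_div_iff₀ (by positivity) hp] at h
    nlinarith
  have hbound : l 0 / qval l b₀ ≤ eta0 (Function.update w 0 (w 0 + Δx)) l := by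
    refine le_trans ?_ hη'
    rw [← div_div]
    gcongr
    rw [le_div_iff₀ (by positivity)]
    linarith
  exact ⟨by linarith, hbound, hbound.trans hlt.le⟩
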